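/- arXiv:math/0411266 — 5 statements merged into one kernel-verified Lean document; each statement's English description precedes it below -/
import Mathlib

section
/- Let E be a finite-dimensional real vector space and let U ⊆ E be a nonempty open convex subset stable under multiplication by positive real scalars. Let P(U) = {f ∈ E* : f(v) ≥ 0 for all v ∈ U} be the dual cone in E*. If W ⊆ E* is a linear subspace with W ∩ P(U) = {0}, then the preannihilator W⊥ = {v ∈ E : f(v) = 0 for all f ∈ W} satisfies W⊥ ∩ U ≠ ∅. -/
/-- Converse direction of the orthogonality lemma (Gaitsgory–Nadler, Section 2):
if `U ⊆ E` is a nonempty open convex subset stable under positive scalar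
multiplication, and `W` is a subspace of the dual space meeting the dual cone
`P(U)` only at `0`, then the preannihilator of `W` meets `U`. -/
theorem stmt_2 {E : Type*} [NormedAddCommGroup E] [NormedSpace ℝ E]
    [FiniteDimensional ℝ E] (U : Set E) (hne : U.Nonempty) (hU : IsOpen U)
    (hconv : Convex ℝ U) (hcone : ∀ c : ℝ, 0 < c → ∀ v ∈ U, c • v ∈ U)
    (W : Submodule ℝ (E →ₗ[ℝ] ℝ))
    (hW : (W : Set (E →ₗ[ℝ] ℝ)) ∩ {f : E →ₗ[ℝ] ℝ | ∀ v ∈ U, 0 ≤ f v} = {0}) :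
    ({v : E | ∀ f ∈ W, f v = 0} ∩ U).Nonempty := by
  by_contra hempty
  have hdisj : Disjoint U (W.dualCoannihilator : Set E) := by
    rw [Set.disjoint_left]
    intro v hvU hvW
    exact hempty ⟨v, (Submodule.mem_dualCoannihilator v).1 hvW, hvU⟩
  obtain ⟨f, u, hfU, hfW⟩ :=
    geometric_hahn_banach_open hconv hU W.dualCoannihilator.convex hdisj
  have hu : u ≤ 0 := by simpa using hfW 0 (zero_mem _)
  have hf_zero : ∀ b ∈ W.dualCoannihilator, f b = 0 := by
    intro b hb
    by_contra hne_zero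
    have h := hfW (((u - 1) / f b) • b) (Submodule.smul_mem _ _ hb)
    rw [map_smul, smul_eq_mul, div_mul_cancel₀ _ hne_zero] at h
    linarith
  have hf_mem : (f : E →ₗ[ℝ] ℝ) ∈ W := by
    rw [← Subspace.dualCoannihilator_dualAnnihilator_eq (W := W),
      Submodule.mem_dualAnnihilator]
    exact hf_zero
  have hneg_zero : -(f : E →ₗ[ℝ] ℝ) = 0 := by
    have hmem : -(f : E →ₗ[ℝ] ℝ) ∈
        (W : Set (E →ₗ[ℝ] ℝ)) ∩ {f : E →ₗ[ℝ] ℝ | ∀ v ∈ U, 0 ≤ f v} :=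
      ⟨W.neg_mem hf_mem, fun v hv => neg_nonneg.2 ((hfU v hv).le.trans hu)⟩
    rwa [hW] at hmem
  obtain ⟨v, hv⟩ := hne
  have hfv : -f v = 0 := LinearMap.congr_fun hneg_zero v
  linarith [hfU v hv]
end

section
/- Let E be a finite-dimensional real vector space and let U ⊆ E be a nonempty open convex subset stable under multiplication by positive real scalars. Let P(U) = {f ∈ E* : f(v) ≥ 0 for all v ∈ U} be the dual cone in E*. Then the map sending a subspace W̌ ⊆ E to its annihilator W̌⊥ ⊆ E* is a bijection from the set of all linear subspaces W̌ ⊆ E such that W̌ ∩ U ≠ ∅ onto the set of all linear subspaces W ⊆ E* such that W ∩ P(U) = {0}. -/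
/-- A linear functional that is nonnegative on an open set and vanishes at one of its points
is zero. -/
theorem dual_eq_zero_of_nonneg_of_isOpen {E : Type*} [NormedAddCommGroup E] [NormedSpace ℝ E]
    [FiniteDimensional ℝ E] {U : Set E} (hU : IsOpen U) {f : Module.Dual ℝ E}
    (hf : ∀ v ∈ U, 0 ≤ f v) {v : E} (hv : v ∈ U) (hfv : f v = 0) : f = 0 := by
  have hmin : IsLocalMin (LinearMap.toContinuousLinearMap f) v := by
    filter_upwards [hU.mem_nhds hv] with x hx
    simpa [hfv] using hf x hx
  have h := hmin.hasFDerivAt_eq_zero (LinearMap.toContinuousLinearMap f).hasFDerivAt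
  simpa using h

/-- A linear functional that is bounded below on a subspace vanishes on it. -/
theorem mem_dualAnnihilator_of_bddBelow {E : Type*} [AddCommGroup E] [Module ℝ E]
    {W : Submodule ℝ E} {f : Module.Dual ℝ E} {u : ℝ} (h : ∀ w ∈ W, u ≤ f w) :
    f ∈ W.dualAnnihilator := by
  rw [Submodule.mem_dualAnnihilator]
  intro w hw
  by_contra hne
  have h' := h (((u - 1) / f w) • w) (W.smul_mem _ hw)
  rw [map_smul, smul_eq_mul, div_mul_cancel₀ _ hne] at h'
  linarith

/-- A subspace disjoint from an open convex set is annihilated by a functional that is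
positive on that set. -/
theorem exists_mem_dualAnnihilator_pos {E : Type*} [NormedAddCommGroup E] [NormedSpace ℝ E]
    {U : Set E} (hU : IsOpen U) (hconv : Convex ℝ U) {W : Submodule ℝ E}
    (hdisj : Disjoint U (W : Set E)) : ∃ f ∈ W.dualAnnihilator, ∀ v ∈ U, 0 < f v := by
  obtain ⟨f, u, hfU, hfW⟩ := geometric_hahn_banach_open hconv hU W.convex hdisj
  have hu : u ≤ 0 := by simpa using hfW 0 W.zero_mem
  refine ⟨-(f : E →ₗ[ℝ] ℝ), neg_mem (mem_dualAnnihilator_of_bddBelow hfW), fun v hv => ?_⟩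
  simpa using (hfU v hv).trans_le hu

/-- A subspace meets a nonempty open convex set if and only if its annihilator meets the dual
cone only at zero. -/
theorem dualAnnihilator_inter_dualCone_eq_zero_iff {E : Type*} [NormedAddCommGroup E]
    [NormedSpace ℝ E] [FiniteDimensional ℝ E] {U : Set E} (hne : U.Nonempty) (hU : IsOpen U)
    (hconv : Convex ℝ U) (W : Submodule ℝ E) :
    (W.dualAnnihilator : Set (Module.Dual ℝ E)) ∩
        {f : Module.Dual ℝ E | ∀ v ∈ U, 0 ≤ f v} = {0} ↔ ((W : Set E) ∩ U).Nonempty := by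
  constructor
  · intro h
    by_contra hW
    rw [Set.not_nonempty_iff_eq_empty, ← Set.disjoint_iff_inter_eq_empty] at hW
    obtain ⟨f, hfW, hf⟩ := exists_mem_dualAnnihilator_pos hU hconv hW.symm
    obtain rfl : f = 0 := h.subset ⟨hfW, fun v hv => (hf v hv).le⟩
    obtain ⟨v, hv⟩ := hne
    simpa using hf v hv
  · rintro ⟨w, hwW, hwU⟩
    refine Set.Subset.antisymm ?_ ?_
    · rintro f ⟨hfW, hf⟩
      exact dual_eq_zero_of_nonneg_of_isOpen hU hf hwU
        ((Submodule.mem_dualAnnihilator f).1 hfW w hwW)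
    · rintro _ rfl
      exact ⟨zero_mem W.dualAnnihilator, fun v _ => le_rfl⟩

/-- The orthogonality lemma (Gaitsgory–Nadler, Section 2): for a nonempty open
convex subset `U` of a finite-dimensional real vector space `E` which is stable
under positive scalar multiplication, the annihilator map `W̌ ↦ W̌⊥` is a
bijection from the set of subspaces of `E` meeting `U` onto the set of
subspaces of the dual space meeting the dual cone `P(U)` only at `0`. -/
theorem stmt_4 {E : Type*} [NormedAddCommGroup E] [NormedSpace ℝ E]
    [FiniteDimensional ℝ E] (U : Set E) (hne : U.Nonempty) (hU : IsOpen U)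
    (hconv : Convex ℝ U) (hcone : ∀ c : ℝ, 0 < c → ∀ v ∈ U, c • v ∈ U) :
    Set.BijOn (fun W : Submodule ℝ E => W.dualAnnihilator)
      {W : Submodule ℝ E | ((W : Set E) ∩ U).Nonempty}
      {W : Submodule ℝ (Module.Dual ℝ E) |
        (W : Set (Module.Dual ℝ E)) ∩
          {f : Module.Dual ℝ E | ∀ v ∈ U, 0 ≤ f v} = {0}} := by
  have key := dualAnnihilator_inter_dualCone_eq_zero_iff hne hU hconv
  refine ⟨fun W hW => (key W).2 hW, fun W₁ _ W₂ _ h => ?_, fun W hW => ?_⟩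
  · exact Subspace.dualAnnihilator_inj.1 h
  · have hann : W.dualCoannihilator.dualAnnihilator = W :=
      Subspace.dualCoannihilator_dualAnnihilator_eq
    refine ⟨W.dualCoannihilator, (key _).1 ?_, hann⟩
    rw [hann]
    exact hW
end

section
/- Let M be a finitely generated additive submonoid of ℤⁿ and let L be a subgroup of ℤⁿ such that L ∩ M = {0}. Then for every θ ∈ ℤⁿ, the set {φ ∈ L : θ + φ ∈ M} is finite; equivalently, the coset θ + L intersects M in a finite set. -/
/-- In a finitely generated additive submonoid, every infinite sequence has two terms
the later of which is the earlier plus an element of the monoid, by Dickson's lemma. -/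
theorem AddSubmonoid.FG.exists_lt_add_mem {A : Type*} [AddCommMonoid A] {M : AddSubmonoid A}
    (hM : M.FG) (f : ℕ → A) (hf : ∀ k, f k ∈ M) :
    ∃ i j, i < j ∧ ∃ m ∈ M, f j = f i + m := by
  obtain ⟨S, rfl⟩ := hM
  have hc k := AddSubmonoid.mem_closure_finset'.1 (hf k)
  choose c hc using hc
  obtain ⟨i, j, hij, hle⟩ := wellQuasiOrdered_le c
  refine ⟨i, j, hij, ∑ s, (c j s - c i s) • (s : A), ?_, ?_⟩
  · exact AddSubmonoid.sum_mem _ fun s _ => AddSubmonoid.nsmul_mem _ (AddSubmonoid.subset_closure s.2) _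
  · rw [hc, hc, ← Finset.sum_add_distrib]
    refine Finset.sum_congr rfl fun s _ => ?_
    rw [← add_nsmul, Nat.add_sub_cancel' (hle s)]

/-- If `M` is a finitely generated additive submonoid of `ℤⁿ` and `L` is a
subgroup with `L ∩ M = {0}`, then every coset `θ + L` meets `M` in a finite
set (Gaitsgory–Nadler, proof that `𝔭 : Bun̄_P → Z̃_can` is ind-finite). -/
theorem stmt_5 {n : ℕ} (M : AddSubmonoid (Fin n → ℤ)) (hM : M.FG)
    (L : AddSubgroup (Fin n → ℤ))
    (hLM : (L : Set (Fin n → ℤ)) ∩ (M : Set (Fin n → ℤ)) = {0}) :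
    ∀ θ : Fin n → ℤ, {φ : Fin n → ℤ | φ ∈ L ∧ θ + φ ∈ M}.Finite := by
  intro θ
  by_contra hinf
  let φ := Set.Infinite.natEmbedding _ hinf
  obtain ⟨i, j, hij, m, hm, h⟩ :=
    hM.exists_lt_add_mem (fun k => θ + (φ k : Fin n → ℤ)) fun k => (φ k).2.2
  have hsub : (φ j : Fin n → ℤ) = φ i + m := by
    simpa only [add_assoc, add_right_inj] using h
  have hmL : m ∈ L := by
    simpa [hsub] using L.sub_mem (φ j).2.1 (φ i).2.1
  have hm0 : m = 0 := by
    simpa only [hLM, Set.mem_singleton_iff] using (show m ∈ (L : Set (Fin n → ℤ)) ∩ M from ⟨hmL, hm⟩)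
  rw [hm0, add_zero] at hsub
  exact hij.ne' (φ.injective (Subtype.ext hsub))
end

section
/- Let M be a finitely generated additive submonoid of ℤⁿ and let L be a subgroup of ℤⁿ such that L ∩ M = {0}. Let ι : ℤⁿ → ℝⁿ be the coordinatewise cast. Then the real linear span of ι(L) intersects the convex cone generated by ι(M) (the set of all finite nonnegative real linear combinations of elements of ι(M)) only in the zero vector. -/
/-- Nonzero elements of the rational span of finitely many nonnegative reals are detected by
rational functionals that are nonnegative on these reals. -/
theorem exists_rat_linearMap_nonneg_ne_zero {κ : Type*} [Finite κ] (c : κ → ℝ)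
    (hc : ∀ i, 0 ≤ c i) {y : ℝ} (hy : y ∈ Submodule.span ℚ (Set.range c)) (hy0 : y ≠ 0) :
    ∃ φ : ℝ →ₗ[ℚ] ℚ, (∀ i, 0 ≤ φ (c i)) ∧ φ y ≠ 0 := by
  have : FiniteDimensional ℚ (Submodule.span ℚ (Set.range c)) :=
    FiniteDimensional.span_of_finite ℚ (Set.finite_range c)
  let V := Submodule.span ℚ (Set.range c)
  let b := Module.finBasis ℚ V
  let d := Module.finrank ℚ V
  let e : V → (Fin d → ℝ) → ℝ := fun v β => ∑ j, (b.repr v j : ℝ) * β j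
  have he : ∀ v : V, e v (fun j => (b j : ℝ)) = v := by
    intro v
    have h := congrArg V.subtype (b.sum_repr v)
    simpa only [map_sum, map_smul, Submodule.subtype_apply, Rat.smul_def] using h
  have hcont : ∀ v : V, Continuous (e v) := fun v => by fun_prop
  have hdense : DenseRange (fun (q : Fin d → ℚ) (j : Fin d) => (q j : ℝ)) :=
    DenseRange.piMap fun _ => Rat.denseRange_cast
  let p : κ → V := fun i => ⟨c i, Submodule.subset_span ⟨i, rfl⟩⟩
  let U : Set (Fin d → ℝ) :=
    (⋂ i ∈ {i | 0 < c i}, {β | 0 < e (p i) β}) ∩ {β | e ⟨y, hy⟩ β ≠ 0}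
  have hU : IsOpen U := by
    refine IsOpen.inter ?_ (isOpen_ne_fun (hcont _) continuous_const)
    exact (Set.toFinite _).isOpen_biInter fun i _ => isOpen_lt continuous_const (hcont _)
  have hUne : U.Nonempty := by
    refine ⟨fun j => (b j : ℝ), ?_, ?_⟩
    · simp only [Set.mem_iInter, Set.mem_ofPred_eq, he]
      exact fun i hi => hi
    · simpa only [Set.mem_ofPred_eq, he] using hy0
  obtain ⟨q, hq, hqy⟩ := hdense.exists_mem_open hU hUne
  obtain ⟨φ, hφ⟩ := LinearMap.exists_extend (b.constr ℚ q)
  have hφe : ∀ v : V, ((φ v : ℚ) : ℝ) = e v (fun j => (q j : ℝ)) := by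
    intro v
    have h : φ v = b.constr ℚ q v := LinearMap.congr_fun hφ v
    rw [h, Module.Basis.constr_apply_fintype]
    simp [e, d]
  refine ⟨φ, fun i => ?_, fun h => hqy ?_⟩
  · rcases (hc i).eq_or_lt with h | h
    · simp [← h]
    · simp only [Set.mem_iInter, Set.mem_ofPred_eq] at hq
      have h' := hq i h
      rw [← hφe] at h'
      exact_mod_cast h'.le
  · rw [← hφe]
    exact_mod_cast h

/-- The rational vectors having a positive integer multiple in `S`. -/
def ratSaturation {ι : Type*} (S : AddSubmonoid (ι → ℤ)) : AddSubmonoid (ι → ℚ) where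
  carrier := {w | ∃ N : ℕ, 0 < N ∧ ∃ m ∈ S, ∀ t, (N : ℚ) * w t = m t}
  zero_mem' := ⟨1, one_pos, 0, S.zero_mem, by simp⟩
  add_mem' := by
    rintro v w ⟨N, hN, m, hm, hv⟩ ⟨N', hN', m', hm', hw⟩
    refine ⟨N * N', Nat.mul_pos hN hN', N' • m + N • m',
      S.add_mem (S.nsmul_mem hm _) (S.nsmul_mem hm' _), fun t => ?_⟩
    have h1 := hv t
    have h2 := hw t
    simp only [Pi.add_apply, nsmul_eq_mul, Pi.mul_apply, Pi.natCast_apply]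
    push_cast
    rw [← h1, ← h2]
    ring

theorem mem_ratSaturation_of_num_smul_mem {ι : Type*} {S : AddSubmonoid (ι → ℤ)} {q : ℚ}
    {m : ι → ℤ} (h : q.num • m ∈ S) : (fun t => q * (m t : ℚ)) ∈ ratSaturation S := by
  refine ⟨q.den, q.den_pos, _, h, fun t => ?_⟩
  simp only [Pi.smul_apply, smul_eq_mul]
  push_cast
  rw [← mul_assoc, Rat.den_mul_eq_num]

theorem linearMap_mul_intCast (φ : ℝ →ₗ[ℚ] ℚ) (r : ℝ) (z : ℤ) :
    φ (r * z) = φ r * z := by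
  rw [mul_comm, ← zsmul_eq_mul, map_zsmul, zsmul_eq_mul, mul_comm]

theorem linearMap_comp_mem_ratSaturation_of_mem_span {ι : Type*} (L : AddSubgroup (ι → ℤ))
    (φ : ℝ →ₗ[ℚ] ℚ) {x : ι → ℝ}
    (hx : x ∈ Submodule.span ℝ
      ((fun (v : ι → ℤ) (i : ι) => (v i : ℝ)) '' (L : Set (ι → ℤ)))) :
    (fun t => φ (x t)) ∈ ratSaturation L.toAddSubmonoid := by
  suffices h : ∀ r : ℝ, (fun t => φ (r * x t)) ∈ ratSaturation L.toAddSubmonoid by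
    simpa using h 1
  induction hx using Submodule.span_induction with
  | mem x hx =>
    obtain ⟨l, hl, rfl⟩ := hx
    intro r
    simp only [linearMap_mul_intCast]
    exact mem_ratSaturation_of_num_smul_mem (L.zsmul_mem hl _)
  | zero =>
    intro r
    simp only [Pi.zero_apply, mul_zero, map_zero]
    exact (ratSaturation L.toAddSubmonoid).zero_mem
  | add x y _ _ hx hy =>
    intro r
    simp only [Pi.add_apply, mul_add, map_add]
    exact (ratSaturation L.toAddSubmonoid).add_mem (hx r) (hy r)
  | smul a x _ hx =>
    intro r
    simpa [mul_assoc] using hx (r * a)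

theorem eq_zero_of_mem_ratSaturation_of_disjoint {ι : Type*} {S T : AddSubmonoid (ι → ℤ)}
    (hST : (S : Set (ι → ℤ)) ∩ T = {0}) {w : ι → ℚ} (hS : w ∈ ratSaturation S)
    (hT : w ∈ ratSaturation T) : w = 0 := by
  obtain ⟨N, hN, l, hl, hwl⟩ := hS
  obtain ⟨N', hN', m, hm, hwm⟩ := hT
  have hlm : N' • l = N • m := by
    ext t
    have h : (N' : ℚ) * l t = N * m t := by
      rw [← hwl, ← hwm]
      ring
    simp only [Pi.smul_apply, nsmul_eq_mul]
    exact_mod_cast h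
  have h0 : N' • l ∈ (S : Set (ι → ℤ)) ∩ T :=
    ⟨S.nsmul_mem hl _, hlm ▸ T.nsmul_mem hm _⟩
  rw [hST, Set.mem_singleton_iff, smul_eq_zero] at h0
  have hl0 : l = 0 := h0.resolve_left hN'.ne'
  ext t
  have h := hwl t
  rw [hl0] at h
  simpa [hN.ne'] using h


/-- If `M` is a finitely generated additive submonoid of `ℤⁿ` and `L` a
subgroup with `L ∩ M = {0}`, then the real span of `L` meets the convex cone
generated by `M` in `ℝⁿ` only at `0`. -/
theorem stmt_6 {n : ℕ} (M : AddSubmonoid (Fin n → ℤ)) (hM : M.FG)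
    (L : AddSubgroup (Fin n → ℤ))
    (hLM : (L : Set (Fin n → ℤ)) ∩ (M : Set (Fin n → ℤ)) = {0}) :
    (Submodule.span ℝ
        ((fun v : Fin n → ℤ => fun i : Fin n => (v i : ℝ)) '' (L : Set (Fin n → ℤ))) :
        Set (Fin n → ℝ)) ∩
      {x : Fin n → ℝ | ∃ (k : ℕ) (c : Fin k → ℝ) (s : Fin k → (Fin n → ℝ)),
        (∀ i, 0 ≤ c i) ∧
        (∀ i, s i ∈ (fun v : Fin n → ℤ => fun i : Fin n => (v i : ℝ)) '' (M : Set (Fin n → ℤ))) ∧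
        x = ∑ i, c i • s i} = {0} := by
  apply Set.Subset.antisymm
  · rintro x ⟨hxL, k, c, s, hc, hs, rfl⟩
    choose m hm hms using hs
    obtain rfl : (fun i t => (m i t : ℝ)) = s := funext hms
    rw [Set.mem_singleton_iff]
    ext t
    by_contra ht
    have hy : (∑ i, c i • fun t => (m i t : ℝ)) t ∈ Submodule.span ℚ (Set.range c) := by
      simp only [Finset.sum_apply, Pi.smul_apply, smul_eq_mul]
      refine Submodule.sum_mem _ fun i _ => ?_
      rw [mul_comm, ← zsmul_eq_mul]
      exact zsmul_mem (Submodule.subset_span (Set.mem_range_self i)) _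
    obtain ⟨φ, hφ, hφt⟩ := exists_rat_linearMap_nonneg_ne_zero c hc hy ht
    refine hφt (congr_fun (eq_zero_of_mem_ratSaturation_of_disjoint
      (S := L.toAddSubmonoid) (T := M) hLM (linearMap_comp_mem_ratSaturation_of_mem_span L φ hxL) ?_) t)
    have hsum : (fun t => φ ((∑ i, c i • fun t => (m i t : ℝ)) t)) =
        ∑ i, fun t => φ (c i) * (m i t : ℚ) := by
      ext t
      simp [linearMap_mul_intCast]
    rw [hsum]
    refine sum_mem fun i _ => mem_ratSaturation_of_num_smul_mem ?_
    rw [← Int.toNat_of_nonneg (Rat.num_nonneg.2 (hφ i)), natCast_zsmul]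
    exact M.nsmul_mem (hm i) _
  · rw [Set.singleton_subset_iff]
    refine ⟨Submodule.zero_mem _, ?_⟩
    rw [Set.mem_ofPred_eq]
    exact ⟨0, Fin.elim0, Fin.elim0, fun i => i.elim0, fun i => i.elim0, by simp⟩
end

section
/- Let E be a finite-dimensional real normed vector space, let S ⊆ E be a finite set, and let C be the convex cone generated by S, i.e. the set of all finite nonnegative real linear combinations of elements of S. Let W ⊆ E be a linear subspace with W ∩ C = {0}. Then for every θ ∈ E, the set (θ + W) ∩ C is bounded. -/
/-- Every nonnegative preimage of a point under a continuous linear map can be replaced by one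
whose coordinate sum is minimal. -/
lemma exists_nonneg_preimage_sum_le {ι E : Type*} [Fintype ι] [NormedAddCommGroup E]
    [NormedSpace ℝ E] (T : (ι → ℝ) →L[ℝ] E) {a : ι → ℝ} (ha : 0 ≤ a) :
    ∃ c : ι → ℝ, 0 ≤ c ∧ T c = T a ∧ ∀ b, 0 ≤ b → T b = T a → ∑ i, c i ≤ ∑ i, b i := by
  have hsum : Continuous fun c : ι → ℝ => ∑ i, c i := by fun_prop
  have hK : IsCompact (Set.Icc (0 : ι → ℝ) (fun _ => ∑ i, a i) ∩ {c | T c = T a}) :=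
    isCompact_Icc.inter_right (isClosed_eq T.continuous continuous_const)
  have hle {b : ι → ℝ} (hb : 0 ≤ b) (h : ∑ i, b i ≤ ∑ i, a i) :
      b ∈ Set.Icc (0 : ι → ℝ) (fun _ => ∑ i, a i) :=
    ⟨hb, fun i => (Finset.single_le_sum (fun j _ => hb j) (Finset.mem_univ i)).trans h⟩
  obtain ⟨c, ⟨hc, hTc⟩, hmin⟩ := hK.exists_isMinOn ⟨a, hle ha le_rfl, rfl⟩ hsum.continuousOn
  refine ⟨c, hc.1, hTc, fun b hb hTb => ?_⟩
  rcases le_total (∑ i, b i) (∑ i, a i) with h | h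
  · exact hmin ⟨hle hb h, hTb⟩
  · exact (show ∑ i, c i ≤ ∑ i, a i from hmin ⟨hle ha le_rfl, rfl⟩).trans h

open Filter Topology in
/-- If a subspace `W` meets the image of the nonnegative orthant only at `0`, then the points of
that image in a translate of `W` have uniformly bounded nonnegative preimages. -/
lemma exists_norm_le_nonneg_preimage {ι E : Type*} [Fintype ι] [NormedAddCommGroup E]
    [NormedSpace ℝ E] [FiniteDimensional ℝ E] (T : (ι → ℝ) →L[ℝ] E) (W : Submodule ℝ E)
    (hW : ∀ c, 0 ≤ c → T c ∈ W → T c = 0) (θ : E) :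
    ∃ R : ℝ, ∀ a, 0 ≤ a → T a - θ ∈ W → ∃ c, T c = T a ∧ ‖c‖ ≤ R := by
  by_contra! h
  choose a ha haW hbig using fun n : ℕ => h n
  choose c hc hTc hmin using fun n => exists_nonneg_preimage_sum_le T (ha n)
  have hnorm (n : ℕ) : (n : ℝ) < ‖c n‖ := hbig n _ (hTc n)
  have hpos n : 0 < ‖c n‖ := n.cast_nonneg.trans_lt (hnorm n)
  have hsphere n : ‖c n‖⁻¹ • c n ∈ Metric.sphere (0 : ι → ℝ) 1 := by
    simp [norm_smul, (hpos n).ne']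
  obtain ⟨d, hd, φ, hφ, hlim⟩ := (isCompact_sphere (0 : ι → ℝ) 1).tendsto_subseq hsphere
  have hcoord i : Tendsto (fun n => ‖c (φ n)‖⁻¹ * c (φ n) i) atTop (𝓝 (d i)) :=
    (tendsto_pi_nhds.1 hlim) i
  have hd0 : 0 ≤ d := fun i => ge_of_tendsto' (hcoord i) fun n =>
    mul_nonneg (inv_nonneg.2 (norm_nonneg _)) (hc _ i)
  have hinv : Tendsto (fun n => ‖c (φ n)‖⁻¹) atTop (𝓝 0) :=
    tendsto_inv_atTop_zero.comp ((tendsto_atTop_mono (fun n => (hnorm n).le)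
      tendsto_natCast_atTop_atTop).comp hφ.tendsto_atTop)
  have hTdW : T d ∈ W := by
    have hlimT : Tendsto (fun n => T (‖c (φ n)‖⁻¹ • c (φ n)) - ‖c (φ n)‖⁻¹ • θ) atTop
        (𝓝 (T d - (0 : ℝ) • θ)) :=
      ((T.continuous.tendsto d).comp hlim).sub (hinv.smul_const θ)
    rw [zero_smul, sub_zero] at hlimT
    refine W.closed_of_finiteDimensional.mem_of_tendsto hlimT (Eventually.of_forall fun n => ?_)
    rw [map_smul, hTc, ← smul_sub]
    exact W.smul_mem _ (haW _)
  have hTd : T d = 0 := hW d hd0 hTdW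
  have hsum : 0 < ∑ i, d i := by
    refine (Finset.sum_nonneg fun i _ => hd0 i).lt_of_ne' fun h0 => ?_
    have : d = 0 := funext fun i =>
      (Finset.sum_eq_zero_iff_of_nonneg fun i _ => hd0 i).1 h0 i (Finset.mem_univ i)
    simp [this] at hd
  have hev : ∀ᶠ n in atTop, ∀ i, d i / 2 ≤ ‖c (φ n)‖⁻¹ * c (φ n) i := by
    refine eventually_all.2 fun i => ?_
    rcases (hd0 i).eq_or_lt with hi | hi
    · refine Eventually.of_forall fun n => ?_
      rw [← hi]
      simpa using mul_nonneg (inv_nonneg.2 (norm_nonneg (c (φ n)))) (hc (φ n) i)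
    · exact (hcoord i).eventually (eventually_ge_nhds (half_lt_self hi))
  obtain ⟨n, hn⟩ := hev.exists
  have hshift : 0 ≤ c (φ n) - (‖c (φ n)‖ / 2) • d := fun i => by
    have h1 := mul_le_mul_of_nonneg_left (hn i) (hpos (φ n)).le
    rw [mul_inv_cancel_left₀ (hpos (φ n)).ne'] at h1
    simp only [Pi.zero_apply, Pi.sub_apply, Pi.smul_apply, smul_eq_mul]
    linarith
  have hle := hmin (φ n) _ hshift (by rw [map_sub, map_smul, hTd, smul_zero, sub_zero, hTc])
  simp only [Pi.sub_apply, Pi.smul_apply, smul_eq_mul, Finset.sum_sub_distrib,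
    ← Finset.mul_sum] at hle
  have := mul_pos (half_pos (hpos (φ n))) hsum
  linarith


/-- If `C` is the convex cone generated by a finite subset `S` of a
finite-dimensional real normed vector space and `W` is a subspace with
`W ∩ C = {0}`, then every affine translate `θ + W` meets `C` in a bounded
set. -/
theorem stmt_8 {E : Type*} [NormedAddCommGroup E] [NormedSpace ℝ E]
    [FiniteDimensional ℝ E] (S : Set E) (hS : S.Finite) (C : Set E)
    (hC : C = {x : E | ∃ (k : ℕ) (c : Fin k → ℝ) (s : Fin k → E),
      (∀ i, 0 ≤ c i) ∧ (∀ i, s i ∈ S) ∧ x = ∑ i, c i • s i})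
    (W : Submodule ℝ E) (hW : (W : Set E) ∩ C = {0}) :
    ∀ θ : E, Bornology.IsBounded (((fun w => θ + w) '' (W : Set E)) ∩ C) := by
  classical
  intro θ
  have := hS.fintype
  let T : (S → ℝ) →L[ℝ] E := LinearMap.toContinuousLinearMap
    (Fintype.linearCombination ℝ ((↑) : S → E))
  have hT (c : S → ℝ) : T c = ∑ s, c s • (s : E) := Fintype.linearCombination_apply ..
  have hTC (c : S → ℝ) (hc : 0 ≤ c) : T c ∈ C := by
    rw [hC]
    refine ⟨Fintype.card S, fun i => c ((Fintype.equivFin S).symm i),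
      fun i => (Fintype.equivFin S).symm i, fun i => hc _, fun i => Subtype.coe_prop _, ?_⟩
    rw [hT]
    exact ((Fintype.equivFin S).symm.sum_comp fun s => c s • (s : E)).symm
  have hCT (x : E) (hx : x ∈ C) : ∃ c : S → ℝ, 0 ≤ c ∧ T c = x := by
    rw [hC] at hx
    obtain ⟨k, c, s, hc, hs, rfl⟩ := hx
    refine ⟨∑ i, Pi.single ⟨s i, hs i⟩ (c i), Finset.sum_nonneg fun i _ =>
      Pi.single_nonneg.2 (hc i), ?_⟩
    rw [map_sum]
    refine Finset.sum_congr rfl fun i _ => ?_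
    exact Fintype.linearCombination_apply_single ℝ _ _ _
  obtain ⟨R, hR⟩ := exists_norm_le_nonneg_preimage T W
    (fun c hc hcW => hW.subset ⟨hcW, hTC c hc⟩) θ
  refine isBounded_iff_forall_norm_le.2 ⟨‖T‖ * R, ?_⟩
  rintro _ ⟨⟨w, hw, rfl⟩, hx⟩
  obtain ⟨a, ha, hTa⟩ := hCT _ hx
  obtain ⟨c, hTc, hcR⟩ := hR a ha (by simpa [hTa] using hw)
  simp only [← hTa, ← hTc]
  exact T.le_opNorm_of_le hcR
end
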